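/- arXiv:0906.2815 — 3 statements merged into one kernel-verified Lean document; each statement's English description precedes it below -/
import Mathlib

section
/- Let k be a field of characteristic ≠ 2, let α, β, γ, δ, ε, ζ, κ, λ, μ, b, c, f, m ∈ k, and set A₀ = [[α,β,γ],[δ,ε,ζ],[κ,λ,μ]] and A₁ = [[α₁,β₁,γ₁],[δ₁,ε₁,ζ₁],[κ₁,λ₁,μ₁]] where α₁ = 2α²f - cαδ + bβδ - bαε, β₁ = 2fαβ + bγδ - cαε - bαζ, γ₁ = 2fαγ - cαζ, δ₁ = 2mα² - 2cακ + 2bβκ - 2bαλ, ε₁ = 2mαβ + 2bγκ - 2cαλ - 2bαμ, ζ₁ = 2mαγ - 2cαμ, κ₁ = mαδ - 2fακ + bεκ - bδλ, λ₁ = mαε + bζκ - 2fαλ - bδμ, μ₁ = mαζ - 2fαμ. Define the dual involution h₂(x,y) = (x̄, y) with x̄ = -((δ₁y² + ε₁y + ζ₁)x + 2(κ₁y² + λ₁y + μ₁)) / (2(α₁y² + β₁y + γ₁)x + δ₁y² + ε₁y + ζ₁). Then for all x, y ∈ k such that the denominator of x̄ is nonzero, D(x,y) ≠ 0 and D(x̄,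 y) ≠ 0, one has I(x̄, y) = -I(x,y). -/
open Matrix

noncomputable section

/-- The vector `X(t) = (t², t, 1)` in `k³`. -/
def Xv {k : Type*} [Field k] (t : k) : Fin 3 → k := ![t ^ 2, t, 1]

/-- The biquadratic form `X(x)ᵀ A X(y)` associated to a 3×3 matrix `A`. -/
def Nf {k : Type*} [Field k] (A : Matrix (Fin 3) (Fin 3) k) (x y : k) : k :=
  Xv x ⬝ᵥ A.mulVec (Xv y)

/-- The rational invariant `I(x,y) = N(x,y)/D(x,y)` where `N` uses `A₀` and `D` uses `A₁`. -/
def Iinv {k : Type*} [Field k] (A₀ A₁ : Matrix (Fin 3) (Fin 3) k) (x y : k) : k :=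
  Nf A₀ x y / Nf A₁ x y

/-- If the binary quadratics `P x² + Q x + R` and `A x² + B x + C` are apolar, then the involution
fixing the roots of the second one changes the sign of their quotient. -/
lemma quadratic_div_quadratic_polar_eq_neg {k : Type*} [Field k] {P Q R A B C x x' : k}
    (hapolar : 2 * A * R - B * Q + 2 * C * P = 0)
    (hden : 2 * A * x + B ≠ 0) (hx' : x' = -((B * x + 2 * C) / (2 * A * x + B)))
    (hD : A * x ^ 2 + B * x + C ≠ 0) (hD' : A * x' ^ 2 + B * x' + C ≠ 0) :
    (P * x' ^ 2 + Q * x' + R) / (A * x' ^ 2 + B * x' + C) =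
      -((P * x ^ 2 + Q * x + R) / (A * x ^ 2 + B * x + C)) := by
  have hmul : x' * (2 * A * x + B) = -(B * x + 2 * C) := by
    rw [hx', neg_mul, div_mul_cancel₀ _ hden]
  have hDmul : (A * x' ^ 2 + B * x' + C) * (2 * A * x + B) ^ 2 =
      (4 * A * C - B ^ 2) * (A * x ^ 2 + B * x + C) := by
    linear_combination (A * (x' * (2 * A * x + B) - (B * x + 2 * C)) +
      B * (2 * A * x + B)) * hmul
  have hNmul : (P * x' ^ 2 + Q * x' + R) * (2 * A * x + B) ^ 2 =
      -((4 * A * C - B ^ 2) * (P * x ^ 2 + Q * x + R)) := by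
    linear_combination (P * (x' * (2 * A * x + B) - (B * x + 2 * C)) +
      Q * (2 * A * x + B)) * hmul + 2 * (A * x ^ 2 + B * x + C) * hapolar
  rw [← neg_div, div_eq_div_iff hD' hD]
  apply mul_right_cancel₀ (pow_ne_zero 2 hden)
  linear_combination (A * x ^ 2 + B * x + C) * hNmul + (P * x ^ 2 + Q * x + R) * hDmul

lemma Nf_eq_quadratic {k : Type*} [Field k] (a b c d e f g h i x y : k) :
    Nf !![a, b, c; d, e, f; g, h, i] x y =
      (a * y ^ 2 + b * y + c) * x ^ 2 + (d * y ^ 2 + e * y + f) * x +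
        (g * y ^ 2 + h * y + i) := by
  simp [Nf, Xv, dotProduct, mulVec, Fin.sum_univ_three]
  ring

theorem stmt10 {k : Type*} [Field k] (hchar : (2 : k) ≠ 0)
    (α β γ δ ε ζ κ lam μ b c f m : k)
(α₁ β₁ γ₁ δ₁ ε₁ ζ₁ κ₁ lam₁ μ₁ : k)
    (hα₁ : α₁ = 2 * α ^ 2 * f - c * α * δ + b * β * δ - b * α * ε)
    (hβ₁ : β₁ = 2 * f * α * β + b * γ * δ - c * α * ε - b * α * ζ)
    (hγ₁ : γ₁ = 2 * f * α * γ - c * α * ζ)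
    (hδ₁ : δ₁ = 2 * m * α ^ 2 - 2 * c * α * κ + 2 * b * β * κ - 2 * b * α * lam)
    (hε₁ : ε₁ = 2 * m * α * β + 2 * b * γ * κ - 2 * c * α * lam - 2 * b * α * μ)
    (hζ₁ : ζ₁ = 2 * m * α * γ - 2 * c * α * μ)
    (hκ₁ : κ₁ = m * α * δ - 2 * f * α * κ + b * ε * κ - b * δ * lam)
    (hlam₁ : lam₁ = m * α * ε + b * ζ * κ - 2 * f * α * lam - b * δ * μ)
    (hμ₁ : μ₁ = m * α * ζ - 2 * f * α * μ)
    (A₀ A₁ : Matrix (Fin 3) (Fin 3) k)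
    (hA₀ : A₀ = !![α, β, γ; δ, ε, ζ; κ, lam, μ])
    (hA₁ : A₁ = !![α₁, β₁, γ₁; δ₁, ε₁, ζ₁; κ₁, lam₁, μ₁])
    (x y x' : k)
    (hden : 2 * (α₁ * y ^ 2 + β₁ * y + γ₁) * x + (δ₁ * y ^ 2 + ε₁ * y + ζ₁) ≠ 0)
    (hx' : x' = -(((δ₁ * y ^ 2 + ε₁ * y + ζ₁) * x + 2 * (κ₁ * y ^ 2 + lam₁ * y + μ₁)) /
      (2 * (α₁ * y ^ 2 + β₁ * y + γ₁) * x + (δ₁ * y ^ 2 + ε₁ * y + ζ₁))))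
    (hD : Nf A₁ x y ≠ 0) (hD' : Nf A₁ x' y ≠ 0) :
    Iinv A₀ A₁ x' y = -Iinv A₀ A₁ x y := by
  subst hA₀ hA₁
  rw [Nf_eq_quadratic] at hD hD'
  simp only [Iinv, Nf_eq_quadratic]
  refine quadratic_div_quadratic_polar_eq_neg ?_ hden hx' hD hD'
  rw [hα₁, hβ₁, hγ₁, hδ₁, hε₁, hζ₁, hκ₁, hlam₁, hμ₁]
  ring
end
end

section
/- Let k be a field of characteristic ≠ 2, let α, β, γ, δ, ε, ζ, κ, λ, μ, b, c, f, m ∈ k, set A₀ = [[α,β,γ],[δ,ε,ζ],[κ,λ,μ]] and let A₁ be the matrix with entries α₁ = 2α²f - cαδ + bβδ - bαε, β₁ = 2fαβ + bγδ - cαε - bαζ, γ₁ = 2fαγ - cαζ, δ₁ = 2mα² - 2cακ + 2bβκ - 2bαλ, ε₁ = 2mαβ + 2bγκ - 2cαλ - 2bαμ, ζ₁ = 2mαγ - 2cαμ, κ₁ = mαδ - 2fακ + bεκ - bδλ, λ₁ = mαε + bζκ - 2fαλ - bδμ, μ₁ = mαζ - 2fαμ. Define the dual asymmetric non-QRT map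 φ(x,y) = (x̄, ȳ) where x̄ = -((δ₁y² + ε₁y + ζ₁)x + 2(κ₁y² + λ₁y + μ₁)) / (2(α₁y² + β₁y + γ₁)x + δ₁y² + ε₁y + ζ₁) and ȳ = (g₁(x̄) - y g₂(x̄)) / (g₂(x̄) - y g₃(x̄)) with (g₁(x), g₂(x), g₃(x)) = (A₀ᵀX(x)) × (A₁ᵀX(x)). Then for all x, y ∈ k such that all denominators appearing are nonzero and D(x,y) ≠ 0, D(x̄, y) ≠ 0, D(x̄, ȳ) ≠ 0, one has I(x̄, ȳ) = -I(x,y); in particular φ preserves the biquartic invariant I². -/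
open Matrix

noncomputable section

/-- The involution fixing the roots of `A t² + B t + C` sends this quadratic form to a multiple of
itself, and negates the corresponding ratio with any apolar quadratic `P t² + Q t + R`. -/
theorem quadratic_harmonic_conjugate {k : Type*} [Field k] {A B C P Q R x x' : k}
    (hden : 2 * A * x + B ≠ 0) (hx' : x' = -((B * x + 2 * C) / (2 * A * x + B)))
    (hap : 2 * P * C - Q * B + 2 * R * A = 0) :
    (P * x' ^ 2 + Q * x' + R) * (A * x ^ 2 + B * x + C) +
      (P * x ^ 2 + Q * x + R) * (A * x' ^ 2 + B * x' + C) = 0 := by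
  have hw : x' * (2 * A * x + B) = -(B * x + 2 * C) := by
    rw [hx', neg_mul, div_mul_cancel₀ _ hden]
  set w := 2 * A * x + B with hwdef
  have expand : ∀ a b c : k, (a * x' ^ 2 + b * x' + c) * w ^ 2 =
      a * (B * x + 2 * C) ^ 2 - b * (B * x + 2 * C) * w + c * w ^ 2 := fun a b c => by
    linear_combination (a * (x' * w - (B * x + 2 * C)) + b * w) * hw
  refine (mul_eq_zero.mp ?_).resolve_right (pow_ne_zero 2 hden)
  rw [add_mul, mul_right_comm, expand, mul_assoc (P * x ^ 2 + Q * x + R), expand, hwdef]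
  linear_combination 2 * (A * x ^ 2 + B * x + C) ^ 2 * hap

/-- The second root of a pencil of quadratics through `y` lies on the same member of the pencil. -/
theorem dotProduct_Xv_mul_eq_of_crossProduct {k : Type*} [Field k] (u v : Fin 3 → k) {y y' : k}
    (hden : crossProduct u v 1 - y * crossProduct u v 2 ≠ 0)
    (hy' : y' = (crossProduct u v 0 - y * crossProduct u v 1) /
      (crossProduct u v 1 - y * crossProduct u v 2)) :
    u ⬝ᵥ Xv y' * v ⬝ᵥ Xv y = u ⬝ᵥ Xv y * v ⬝ᵥ Xv y' := by
  rw [eq_div_iff hden] at hy'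
  simp [cross_apply, Xv, dotProduct, Fin.sum_univ_three] at hy' ⊢
  linear_combination (y - y') * hy'

theorem Nf_eq_transpose_mulVec_dotProduct {k : Type*} [Field k] (A : Matrix (Fin 3) (Fin 3) k)
    (x y : k) : Nf A x y = Aᵀ.mulVec (Xv x) ⬝ᵥ Xv y := by
  rw [Nf, dotProduct_mulVec, mulVec_transpose]

theorem Nf_of {k : Type*} [Field k] (a₁ a₂ a₃ b₁ b₂ b₃ c₁ c₂ c₃ x y : k) :
    Nf !![a₁, a₂, a₃; b₁, b₂, b₃; c₁, c₂, c₃] x y =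
      (a₁ * y ^ 2 + a₂ * y + a₃) * x ^ 2 + (b₁ * y ^ 2 + b₂ * y + b₃) * x +
        (c₁ * y ^ 2 + c₂ * y + c₃) := by
  simp [Nf, Xv, mulVec, dotProduct, Fin.sum_univ_three]
  ring

theorem stmt12 {k : Type*} [Field k] (hchar : (2 : k) ≠ 0)
    (α β γ δ ε ζ κ lam μ b c f m : k)
(α₁ β₁ γ₁ δ₁ ε₁ ζ₁ κ₁ lam₁ μ₁ : k)
    (hα₁ : α₁ = 2 * α ^ 2 * f - c * α * δ + b * β * δ - b * α * ε)
    (hβ₁ : β₁ = 2 * f * α * β + b * γ * δ - c * α * ε - b * α * ζ)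
    (hγ₁ : γ₁ = 2 * f * α * γ - c * α * ζ)
    (hδ₁ : δ₁ = 2 * m * α ^ 2 - 2 * c * α * κ + 2 * b * β * κ - 2 * b * α * lam)
    (hε₁ : ε₁ = 2 * m * α * β + 2 * b * γ * κ - 2 * c * α * lam - 2 * b * α * μ)
    (hζ₁ : ζ₁ = 2 * m * α * γ - 2 * c * α * μ)
    (hκ₁ : κ₁ = m * α * δ - 2 * f * α * κ + b * ε * κ - b * δ * lam)
    (hlam₁ : lam₁ = m * α * ε + b * ζ * κ - 2 * f * α * lam - b * δ * μ)
    (hμ₁ : μ₁ = m * α * ζ - 2 * f * α * μ)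
    (A₀ A₁ : Matrix (Fin 3) (Fin 3) k)
    (hA₀ : A₀ = !![α, β, γ; δ, ε, ζ; κ, lam, μ])
    (hA₁ : A₁ = !![α₁, β₁, γ₁; δ₁, ε₁, ζ₁; κ₁, lam₁, μ₁])
    (x y x' y' : k)
    (hden : 2 * (α₁ * y ^ 2 + β₁ * y + γ₁) * x + (δ₁ * y ^ 2 + ε₁ * y + ζ₁) ≠ 0)
    (hx' : x' = -(((δ₁ * y ^ 2 + ε₁ * y + ζ₁) * x + 2 * (κ₁ * y ^ 2 + lam₁ * y + μ₁)) /
      (2 * (α₁ * y ^ 2 + β₁ * y + γ₁) * x + (δ₁ * y ^ 2 + ε₁ * y + ζ₁))))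
    (g : Fin 3 → k) (hg : g = crossProduct (A₀ᵀ.mulVec (Xv x')) (A₁ᵀ.mulVec (Xv x')))
    (hdeng : g 1 - y * g 2 ≠ 0)
    (hy' : y' = (g 0 - y * g 1) / (g 1 - y * g 2))
    (hD : Nf A₁ x y ≠ 0) (hD' : Nf A₁ x' y ≠ 0) (hD'' : Nf A₁ x' y' ≠ 0) :
    Iinv A₀ A₁ x' y' = -Iinv A₀ A₁ x y ∧
    (Iinv A₀ A₁ x' y') ^ 2 = (Iinv A₀ A₁ x y) ^ 2 := by
  have horizontal : Iinv A₀ A₁ x' y = -Iinv A₀ A₁ x y := by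
    have hap : 2 * (α * y ^ 2 + β * y + γ) * (κ₁ * y ^ 2 + lam₁ * y + μ₁) -
        (δ * y ^ 2 + ε * y + ζ) * (δ₁ * y ^ 2 + ε₁ * y + ζ₁) +
        2 * (κ * y ^ 2 + lam * y + μ) * (α₁ * y ^ 2 + β₁ * y + γ₁) = 0 := by
      subst hα₁ hβ₁ hγ₁ hδ₁ hε₁ hζ₁ hκ₁ hlam₁ hμ₁
      ring
    have h := quadratic_harmonic_conjugate hden hx' hap
    rw [← Nf_of, ← Nf_of, ← Nf_of, ← Nf_of, ← hA₀, ← hA₁] at h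
    rw [Iinv, Iinv, ← neg_div, div_eq_div_iff hD' hD]
    linear_combination h
  have vertical : Iinv A₀ A₁ x' y' = Iinv A₀ A₁ x' y := by
    subst hg
    rw [Iinv, Iinv, div_eq_div_iff hD'' hD']
    simp only [Nf_eq_transpose_mulVec_dotProduct]
    exact dotProduct_Xv_mul_eq_of_crossProduct _ _ hdeng hy'
  have key := vertical.trans horizontal
  exact ⟨key, by rw [key, neg_sq]⟩
end
end

section
/- Let k be a field of characteristic ≠ 2 and let α, β, γ, δ, ε, μ ∈ k. Set A₀ = [[α,β,γ],[β,ε,δ],[γ,δ,μ]] and A₁ = [[α₁,β₁,γ₁],[β₁,ε₁,δ₁],[γ₁,δ₁,μ₁]] where α₁ = αε - β², β₁ = 2αδ - 2βγ, γ₁ = βδ - γε, ε₁ = 4αμ - 4γ², δ₁ = 2βμ - 2γδ, μ₁ = εμ - δ². Define the symmetric non-QRT map φ(x,y) = (y, ȳ) with ȳ = -(2γy² + 2δy + 2μ + x(βy² + εy + δ)) / (βy² + εy + δ + 2x(αy² + βy + γ)). Then for all x, y ∈ k such that the denominator of ȳ is nonzero, D(x,y) ≠ 0 and D(y, ȳ)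 ≠ 0, one has I(y, ȳ) = -I(x,y); in particular φ preserves the biquartic invariant I². -/
open Matrix

noncomputable section

theorem Nf_of_s13 {k : Type*} [Field k] (a b c d e f g h i x y : k) :
    Nf !![a, b, c; d, e, f; g, h, i] x y =
      x ^ 2 * (a * y ^ 2 + b * y + c) + x * (d * y ^ 2 + e * y + f) +
        (g * y ^ 2 + h * y + i) := by
  simp [Nf, Xv, Matrix.mulVec, dotProduct, Fin.sum_univ_three]

theorem stmt13 {k : Type*} [Field k] (hchar : (2 : k) ≠ 0)
    (α β γ δ ε μ : k)
(α₁ β₁ γ₁ ε₁ δ₁ μ₁ : k)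
    (hα₁ : α₁ = α * ε - β ^ 2)
    (hβ₁ : β₁ = 2 * α * δ - 2 * β * γ)
    (hγ₁ : γ₁ = β * δ - γ * ε)
    (hε₁ : ε₁ = 4 * α * μ - 4 * γ ^ 2)
    (hδ₁ : δ₁ = 2 * β * μ - 2 * γ * δ)
    (hμ₁ : μ₁ = ε * μ - δ ^ 2)
    (A₀ A₁ : Matrix (Fin 3) (Fin 3) k)
    (hA₀ : A₀ = !![α, β, γ; β, ε, δ; γ, δ, μ])
    (hA₁ : A₁ = !![α₁, β₁, γ₁; β₁, ε₁, δ₁; γ₁, δ₁, μ₁])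
    (x y y' : k)
    (hden : β * y ^ 2 + ε * y + δ + 2 * x * (α * y ^ 2 + β * y + γ) ≠ 0)
    (hy' : y' = -((2 * γ * y ^ 2 + 2 * δ * y + 2 * μ + x * (β * y ^ 2 + ε * y + δ)) /
      (β * y ^ 2 + ε * y + δ + 2 * x * (α * y ^ 2 + β * y + γ))))
    (hD : Nf A₁ x y ≠ 0) (hD' : Nf A₁ y y' ≠ 0) :
    Iinv A₀ A₁ y y' = -Iinv A₀ A₁ x y ∧
    (Iinv A₀ A₁ y y') ^ 2 = (Iinv A₀ A₁ x y) ^ 2 := by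
  have hlin : y' * (β * y ^ 2 + ε * y + δ + 2 * x * (α * y ^ 2 + β * y + γ)) =
      -(2 * γ * y ^ 2 + 2 * δ * y + 2 * μ + x * (β * y ^ 2 + ε * y + δ)) := by
    rw [hy', neg_mul, div_mul_cancel₀ _ hden]
  have hcross : Nf A₀ y y' * Nf A₁ x y = -Nf A₀ x y * Nf A₁ y y' := by
    subst hA₀ hA₁
    simp only [Nf_of_s13]
    apply mul_right_cancel₀ (pow_ne_zero 2 hden)
    -- homogenize `y'` as the quotient `p / q`
    generalize hq : β * y ^ 2 + ε * y + δ + 2 * x * (α * y ^ 2 + β * y + γ) = q at hlin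
    generalize hp : -(2 * γ * y ^ 2 + 2 * δ * y + 2 * μ + x * (β * y ^ 2 + ε * y + δ)) = p at hlin
    have hform (a b c d e f g h i : k) :
        (y ^ 2 * (a * y' ^ 2 + b * y' + c) + y * (d * y' ^ 2 + e * y' + f) +
          (g * y' ^ 2 + h * y' + i)) * q ^ 2 =
        y ^ 2 * (a * p ^ 2 + b * p * q + c * q ^ 2) + y * (d * p ^ 2 + e * p * q + f * q ^ 2) +
          (g * p ^ 2 + h * p * q + i * q ^ 2) := by
      rw [← hlin]
      ring
    rw [mul_right_comm, mul_assoc (-_), hform, hform]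
    subst hp hq hα₁ hβ₁ hγ₁ hε₁ hδ₁ hμ₁
    ring
  have hneg : Iinv A₀ A₁ y y' = -Iinv A₀ A₁ x y := by
    rw [Iinv, Iinv, ← neg_div, div_eq_div_iff hD' hD, hcross]
  exact ⟨hneg, by rw [hneg, neg_sq]⟩
end
end
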